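/- Let c ≤ b ≤ a be natural numbers. Then the number of orbits of the simultaneous row-and-column permutation action of S_b on {M ∈ GL(b,2) : |ε(M)| = c} equals the number of orbits of the corresponding S_a-action on {M ∈ GL(a,2) : |ε(M)| = c}. Moreover, the bijection is realized by M ↦ φ_{b,a}(M): the orbit S_b·M maps to the orbit S_a·φ_{b,a}(M). -/

import Mathlib

/-- The embedding of a `b × b` matrix over `𝔽₂` into the upper-left corner of an
`a × a` matrix, with the identity in the lower-right block and zeros elsewhere. -/
def embedMat (b a : ℕ) (M : Matrix (Fin b) (Fin b) (ZMod 2)) :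
    Matrix (Fin a) (Fin a) (ZMod 2) :=
  fun i j =>
    if hi : (i : ℕ) < b then
      if hj : (j : ℕ) < b then M ⟨i, hi⟩ ⟨j, hj⟩ else 0
    else if i = j then 1 else 0

/-- The set of essential indices of a matrix: `i` is essential if some off-diagonal
entry in row `i` or column `i` equals `1`. -/
def essential {k : ℕ} (M : Matrix (Fin k) (Fin k) (ZMod 2)) : Set (Fin k) :=
  {i | ∃ j, j ≠ i ∧ (M i j = 1 ∨ M j i = 1)}

/-- The orbit of a matrix under the simultaneous row-and-column permutation action
of the symmetric group. -/
def permOrbit {k : ℕ} (M : Matrix (Fin k) (Fin k) (ZMod 2)) :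
    Set (Matrix (Fin k) (Fin k) (ZMod 2)) :=
  {N | ∃ σ : Equiv.Perm (Fin k), N = M.submatrix ⇑σ⁻¹ ⇑σ⁻¹}

/-- `essOrbits k c` is the set of orbits (under simultaneous row-and-column
permutation) of invertible `k × k` matrices over `𝔽₂` with exactly `c` essential
indices. -/
def essOrbits (k c : ℕ) : Set (Set (Matrix (Fin k) (Fin k) (ZMod 2))) :=
  {O | ∃ M : Matrix (Fin k) (Fin k) (ZMod 2),
    IsUnit M ∧ (essential M).ncard = c ∧ O = permOrbit M}

theorem zmod_two_eq_zero_of_ne_one {x : ZMod 2} (h : x ≠ 1) : x = 0 := by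
  revert x; decide

theorem apply_eq_zero_of_notMem_essential {k : ℕ} {M : Matrix (Fin k) (Fin k) (ZMod 2)}
    {i j : Fin k} (hij : i ≠ j) (h : i ∉ essential M ∨ j ∉ essential M) : M i j = 0 := by
  apply zmod_two_eq_zero_of_ne_one
  intro h1
  rcases h with h | h
  · exact h ⟨j, hij.symm, Or.inl h1⟩
  · exact h ⟨i, hij, Or.inr h1⟩

theorem apply_self_eq_one_of_notMem_essential {k : ℕ} {M : Matrix (Fin k) (Fin k) (ZMod 2)}
    (hM : IsUnit M) {i : Fin k} (hi : i ∉ essential M) : M i i = 1 := by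
  by_contra h
  have hrow : ∀ j, M i j = 0 := fun j => by
    by_cases hij : i = j
    · subst hij; exact zmod_two_eq_zero_of_ne_one h
    · exact apply_eq_zero_of_notMem_essential hij (Or.inl hi)
  rw [Matrix.isUnit_iff_isUnit_det, Matrix.det_eq_zero_of_row_eq_zero i hrow] at hM
  exact not_isUnit_zero hM

theorem mem_permOrbit_iff {k : ℕ} {M N : Matrix (Fin k) (Fin k) (ZMod 2)} :
    N ∈ permOrbit M ↔ ∃ σ : Equiv.Perm (Fin k), ∀ i j, N (σ i) (σ j) = M i j := by
  constructor
  · rintro ⟨σ, rfl⟩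
    exact ⟨σ, fun i j => by simp⟩
  · rintro ⟨σ, h⟩
    refine ⟨σ, ?_⟩
    ext i j
    simp [← h]

theorem mem_permOrbit_self {k : ℕ} (M : Matrix (Fin k) (Fin k) (ZMod 2)) : M ∈ permOrbit M :=
  mem_permOrbit_iff.2 ⟨1, fun _ _ => rfl⟩

theorem permOrbit_eq_of_mem {k : ℕ} {M N : Matrix (Fin k) (Fin k) (ZMod 2)}
    (h : N ∈ permOrbit M) : permOrbit M = permOrbit N := by
  obtain ⟨σ, hσ⟩ := mem_permOrbit_iff.1 h
  ext L
  simp only [mem_permOrbit_iff]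
  constructor
  · rintro ⟨τ, hτ⟩
    exact ⟨σ⁻¹.trans τ, fun i j => by simp [hτ, ← hσ]⟩
  · rintro ⟨τ, hτ⟩
    exact ⟨σ.trans τ, fun i j => by simp [hτ, hσ]⟩

theorem map_mem_essential {k l : ℕ} {M : Matrix (Fin k) (Fin k) (ZMod 2)}
    {N : Matrix (Fin l) (Fin l) (ZMod 2)} {f : Fin k → Fin l}
    (hf : Set.InjOn f (essential M))
    (h : ∀ i ∈ essential M, ∀ j ∈ essential M, N (f i) (f j) = M i j) :
    Set.MapsTo f (essential M) (essential N) := by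
  rintro i ⟨j, hji, hij⟩
  have hi : i ∈ essential M := ⟨j, hji, hij⟩
  have hj : j ∈ essential M := ⟨i, hji.symm, hij.symm⟩
  exact ⟨f j, fun e => hji (hf hj hi e), by rwa [h i hi j hj, h j hj i hi]⟩

theorem isUnit_of_mem_permOrbit {k : ℕ} {M N : Matrix (Fin k) (Fin k) (ZMod 2)}
    (h : N ∈ permOrbit M) (hM : IsUnit M) : IsUnit N := by
  obtain ⟨σ, rfl⟩ := h
  exact (Matrix.isUnit_submatrix_equiv (A := M) σ⁻¹ σ⁻¹).2 hM

theorem essential_eq_image {k : ℕ} {M N : Matrix (Fin k) (Fin k) (ZMod 2)}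
    {σ : Equiv.Perm (Fin k)} (h : ∀ i j, N (σ i) (σ j) = M i j) :
    essential N = σ '' essential M := by
  apply Set.Subset.antisymm
  · intro i hi
    refine ⟨σ⁻¹ i, ?_, by simp⟩
    exact map_mem_essential (f := ⇑σ⁻¹) (σ⁻¹.injective.injOn)
      (fun i _ j _ => by simp [← h]) hi
  · rintro _ ⟨i, hi, rfl⟩
    exact map_mem_essential σ.injective.injOn (fun i _ j _ => h i j) hi

theorem ncard_essential_of_mem_permOrbit {k : ℕ} {M N : Matrix (Fin k) (Fin k) (ZMod 2)}
    (h : N ∈ permOrbit M) : (essential N).ncard = (essential M).ncard := by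
  obtain ⟨σ, hσ⟩ := mem_permOrbit_iff.1 h
  rw [essential_eq_image hσ, Set.ncard_image_of_injective _ σ.injective]

/-- Two invertible matrices with equally many essential indices lie in the same orbit as soon as
their restrictions to the essential indices are matched by an injection. -/
theorem mem_permOrbit_of_injOn_essential {k : ℕ} {M N : Matrix (Fin k) (Fin k) (ZMod 2)}
    (hM : IsUnit M) (hN : IsUnit N) (hc : (essential M).ncard = (essential N).ncard)
    {f : Fin k → Fin k} (hf : Set.InjOn f (essential M))
    (h : ∀ i ∈ essential M, ∀ j ∈ essential M, N (f i) (f j) = M i j) :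
    N ∈ permOrbit M := by
  obtain ⟨g, hg⟩ := Set.MapsTo.exists_equiv_extend_of_card_eq (t := Finset.univ)
    (by simp) (s := essential M) (f := f) (fun _ _ => by simp) hf
  let σ : Equiv.Perm (Fin k) := g.trans (Equiv.subtypeUnivEquiv (fun _ => Finset.mem_univ _))
  have hσ : ∀ i ∈ essential M, σ i = f i := hg
  have himage : σ '' essential M = essential N := by
    apply Set.eq_of_subset_of_ncard_le
    · rintro _ ⟨i, hi, rfl⟩
      rw [hσ i hi]
      exact map_mem_essential hf h hi
    · rw [Set.ncard_image_of_injective _ σ.injective, hc]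
    · exact Set.toFinite _
  have hmem : ∀ i, σ i ∈ essential N ↔ i ∈ essential M := fun i => by
    rw [← himage, σ.injective.mem_set_image]
  refine mem_permOrbit_iff.2 ⟨σ, fun i j => ?_⟩
  by_cases hij : i ∈ essential M ∧ j ∈ essential M
  · rw [hσ i hij.1, hσ j hij.2, h i hij.1 j hij.2]
  rw [not_and_or] at hij
  by_cases e : i = j
  · subst e
    have hi : i ∉ essential M := by tauto
    rw [apply_self_eq_one_of_notMem_essential hM hi,
      apply_self_eq_one_of_notMem_essential hN (mt (hmem i).1 hi)]
  · rw [apply_eq_zero_of_notMem_essential e hij,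
      apply_eq_zero_of_notMem_essential (M := N) (σ.injective.ne e) (by rwa [hmem, hmem])]

theorem embedMat_castLE {b a : ℕ} (hba : b ≤ a) (M : Matrix (Fin b) (Fin b) (ZMod 2))
    (i j : Fin b) : embedMat b a M (Fin.castLE hba i) (Fin.castLE hba j) = M i j := by
  simp [embedMat]

theorem isUnit_embedMat_iff {b a : ℕ} (hba : b ≤ a) {M : Matrix (Fin b) (Fin b) (ZMod 2)} :
    IsUnit (embedMat b a M) ↔ IsUnit M := by
  obtain ⟨d, rfl⟩ := Nat.exists_eq_add_of_le hba
  have h : (embedMat b (b + d) M).submatrix finSumFinEquiv finSumFinEquiv =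
      Matrix.fromBlocks M 0 0 1 := by
    ext (i | i) (j | j)
    · simp [embedMat]
    · simp [embedMat]
    · simp [embedMat, Fin.ext_iff]
      omega
    · simp [embedMat, Matrix.one_apply, Fin.ext_iff]
  rw [← Matrix.isUnit_submatrix_equiv finSumFinEquiv finSumFinEquiv, h,
    Matrix.isUnit_fromBlocks_zero₁₂]
  simp

theorem essential_embedMat {b a : ℕ} (hba : b ≤ a) (M : Matrix (Fin b) (Fin b) (ZMod 2)) :
    essential (embedMat b a M) = Fin.castLE hba '' essential M := by
  apply Set.Subset.antisymm
  · rintro i ⟨j, hji, hij⟩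
    have hib : (i : ℕ) < b := by
      by_contra hi
      simp [embedMat, hi, hji, hji.symm] at hij
    have hjb : (j : ℕ) < b := by
      by_contra hj
      simp [embedMat, hj, hji, hib] at hij
    refine ⟨⟨i, hib⟩, ⟨⟨j, hjb⟩, fun e => hji (Fin.ext (congrArg (fun x : Fin b => (x : ℕ)) e)), ?_⟩, rfl⟩
    simpa [embedMat, hib, hjb] using hij
  · rintro _ ⟨i, hi, rfl⟩
    exact map_mem_essential (Fin.castLE_injective hba).injOn
      (fun i _ j _ => embedMat_castLE hba M i j) hi

theorem ncard_essential_embedMat {b a : ℕ} (hba : b ≤ a)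
    (M : Matrix (Fin b) (Fin b) (ZMod 2)) :
    (essential (embedMat b a M)).ncard = (essential M).ncard := by
  rw [essential_embedMat hba, Set.ncard_image_of_injective _ (Fin.castLE_injective hba)]

theorem embedMat_mem_permOrbit_iff {b a : ℕ} (hba : b ≤ a)
    {M N : Matrix (Fin b) (Fin b) (ZMod 2)} (hM : IsUnit M) (hN : IsUnit N) :
    embedMat b a N ∈ permOrbit (embedMat b a M) ↔ N ∈ permOrbit M := by
  constructor
  · intro h
    have hc := ncard_essential_of_mem_permOrbit h
    rw [ncard_essential_embedMat hba, ncard_essential_embedMat hba] at hc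
    obtain ⟨σ, hσ⟩ := mem_permOrbit_iff.1 h
    have hex : ∀ i : Fin b, ∃ j : Fin b, i ∈ essential M →
        Fin.castLE hba j = σ (Fin.castLE hba i) := fun i => by
      by_cases hi : i ∈ essential M
      · have : σ (Fin.castLE hba i) ∈ essential (embedMat b a N) := by
          rw [essential_eq_image hσ, essential_embedMat hba]
          exact Set.mem_image_of_mem _ (Set.mem_image_of_mem _ hi)
        rw [essential_embedMat hba] at this
        obtain ⟨j, -, hj⟩ := this
        exact ⟨j, fun _ => hj⟩
      · exact ⟨i, fun h => absurd h hi⟩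
    choose f hf using hex
    refine mem_permOrbit_of_injOn_essential hM hN hc.symm (f := f) ?_ ?_
    · intro i hi j hj e
      apply Fin.castLE_injective hba
      apply σ.injective
      rw [← hf i hi, ← hf j hj, e]
    · intro i hi j hj
      rw [← embedMat_castLE hba N, hf i hi, hf j hj, hσ, embedMat_castLE]
  · intro h
    obtain ⟨σ, hσ⟩ := mem_permOrbit_iff.1 h
    let f : Fin a → Fin a := fun i => if hi : (i : ℕ) < b then Fin.castLE hba (σ ⟨i, hi⟩) else i
    have hf : ∀ i : Fin b, f (Fin.castLE hba i) = Fin.castLE hba (σ i) := fun i => by simp [f]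
    refine mem_permOrbit_of_injOn_essential ((isUnit_embedMat_iff hba).2 hM)
      ((isUnit_embedMat_iff hba).2 hN) ?_ (f := f) ?_ ?_
    · rw [ncard_essential_embedMat hba, ncard_essential_embedMat hba,
        ncard_essential_of_mem_permOrbit h]
    · rw [essential_embedMat hba]
      rintro _ ⟨i, -, rfl⟩ _ ⟨j, -, rfl⟩ e
      rw [hf, hf] at e
      rw [σ.injective (Fin.castLE_injective hba e)]
    · rw [essential_embedMat hba]
      rintro _ ⟨i, -, rfl⟩ _ ⟨j, -, rfl⟩
      rw [hf, hf, embedMat_castLE, embedMat_castLE, hσ]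

/-- An invertible matrix with at most `b` essential indices can be permuted into the image of
`embedMat b a`. -/
theorem exists_embedMat_mem_permOrbit {b a : ℕ} (hba : b ≤ a)
    {N : Matrix (Fin a) (Fin a) (ZMod 2)} (hN : IsUnit N) (hc : (essential N).ncard ≤ b) :
    ∃ M : Matrix (Fin b) (Fin b) (ZMod 2), embedMat b a M ∈ permOrbit N := by
  classical
  have hcard : Fintype.card (essential N) ≤ Fintype.card (Fin b) := by
    rwa [← Nat.card_eq_fintype_card, Fintype.card_fin]
  obtain ⟨e⟩ := Function.Embedding.nonempty_of_card_le hcard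
  let f : Fin a → Fin a := fun i =>
    if hi : i ∈ essential N then Fin.castLE hba (e ⟨i, hi⟩) else i
  have hf : ∀ i (hi : i ∈ essential N), f i = Fin.castLE hba (e ⟨i, hi⟩) :=
    fun i hi => by simp [f, hi]
  obtain ⟨g, hg⟩ := Set.MapsTo.exists_equiv_extend_of_card_eq (t := Finset.univ)
    (by simp) (s := essential N) (f := f) (fun _ _ => by simp) (by
      intro i hi j hj h
      rw [hf i hi, hf j hj] at h
      simpa using e.injective (Fin.castLE_injective hba h))
  let σ : Equiv.Perm (Fin a) := g.trans (Equiv.subtypeUnivEquiv (fun _ => Finset.mem_univ _))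
  have hσ : ∀ i ∈ essential N, (σ i : ℕ) < b := fun i hi => by
    have : σ i = f i := hg i hi
    rw [this, hf i hi]
    simp
  refine ⟨fun i j => N (σ⁻¹ (Fin.castLE hba i)) (σ⁻¹ (Fin.castLE hba j)),
    mem_permOrbit_iff.2 ⟨σ, fun i j => ?_⟩⟩
  by_cases hi : (σ i : ℕ) < b
  · by_cases hj : (σ j : ℕ) < b
    · simp [embedMat, hi, hj]
    · have hij : i ≠ j := fun h => hj (h ▸ hi)
      simp [embedMat, hi, hj,
        apply_eq_zero_of_notMem_essential hij (Or.inr (mt (hσ j) hj))]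
  · by_cases hij : i = j
    · subst hij
      simp [embedMat, hi, apply_self_eq_one_of_notMem_essential hN (mt (hσ i) hi)]
    · simp [embedMat, hi, hij,
        apply_eq_zero_of_notMem_essential hij (Or.inl (mt (hσ i) hi))]

theorem orbit_count_invariant (c b a : ℕ) (hcb : c ≤ b) (hba : b ≤ a) :
    ∃ Φ : Set (Matrix (Fin b) (Fin b) (ZMod 2)) → Set (Matrix (Fin a) (Fin a) (ZMod 2)),
      Set.BijOn Φ (essOrbits b c) (essOrbits a c) ∧
      ∀ M : Matrix (Fin b) (Fin b) (ZMod 2), IsUnit M → (essential M).ncard = c →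
        Φ (permOrbit M) = permOrbit (embedMat b a M) := by
  let Φ : Set (Matrix (Fin b) (Fin b) (ZMod 2)) → Set (Matrix (Fin a) (Fin a) (ZMod 2)) :=
    fun O => ⋃ M ∈ O, permOrbit (embedMat b a M)
  have hΦ : ∀ M : Matrix (Fin b) (Fin b) (ZMod 2), IsUnit M →
      Φ (permOrbit M) = permOrbit (embedMat b a M) := by
    intro M hM
    apply Set.Subset.antisymm
    · refine Set.iUnion₂_subset fun N hN => ?_
      rw [permOrbit_eq_of_mem ((embedMat_mem_permOrbit_iff hba hM
        (isUnit_of_mem_permOrbit hN hM)).2 hN)]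
    · exact Set.subset_biUnion_of_mem (u := fun M => permOrbit (embedMat b a M))
        (mem_permOrbit_self M)
  refine ⟨Φ, ⟨?_, ?_, ?_⟩, fun M hM _ => hΦ M hM⟩
  · rintro _ ⟨M, hM, hc, rfl⟩
    exact ⟨embedMat b a M, (isUnit_embedMat_iff hba).2 hM,
      (ncard_essential_embedMat hba M).trans hc, hΦ M hM⟩
  · rintro _ ⟨M, hM, -, rfl⟩ _ ⟨N, hN, -, rfl⟩ h
    rw [hΦ M hM, hΦ N hN] at h
    exact permOrbit_eq_of_mem ((embedMat_mem_permOrbit_iff hba hM hN).1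
      (h ▸ mem_permOrbit_self _))
  · rintro _ ⟨N, hN, hc, rfl⟩
    obtain ⟨M, hM⟩ := exists_embedMat_mem_permOrbit hba hN (hc.trans_le hcb)
    have hMu := (isUnit_embedMat_iff hba).1 (isUnit_of_mem_permOrbit hM hN)
    refine ⟨permOrbit M, ⟨M, hMu, ?_, rfl⟩, ?_⟩
    · rw [← ncard_essential_embedMat hba M, ncard_essential_of_mem_permOrbit hM, hc]
    · rw [hΦ M hMu, permOrbit_eq_of_mem hM]
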